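/- Let (X_t)_{t≥0} be an infinite time horizon Brownian bridge with jointly measurable sample paths whose coefficient α is continuous and positive. Then for every x ∈ ℝ and every positive integer p there is a constant C_p (independent of s, t, x and ε) such that for all 0 ≤ s ≤ t with t − s ≤ 1 and all ε > 0, E| L^x_{t,ε} − L^x_{s,ε} |^p ≤ C_p · (p! / Γ((p+1)/2)) · (t − s)^{p/2} · exp(t · α*(t)). -/

import Mathlib

open MeasureTheory ProbabilityTheory Real Filter Set

/-- `Aint α t = ∫₀ᵗ α(u) du`. -/
noncomputable def Aint (α : ℝ → ℝ) (t : ℝ) : ℝ := ∫ u in (0:ℝ)..t, α u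

/-- `alphaStar α t = sup_{0 ≤ r ≤ t} α(r)`. -/
noncomputable def alphaStar (α : ℝ → ℝ) (t : ℝ) : ℝ := sSup (α '' Set.Icc 0 t)

/-- Covariance kernel of the infinite time horizon Brownian bridge. -/
noncomputable def Kker (α : ℝ → ℝ) (s t : ℝ) : ℝ :=
  Real.exp (-(Aint α s) - Aint α t) * ∫ u in (0:ℝ)..(min s t), Real.exp (2 * Aint α u)

/-- `X` is an infinite time horizon Brownian bridge associated with coefficient `α`:
every finite real linear combination of the `X_{t_i}` (for `t_i ≥ 0`) is a centered
Gaussian random variable, and the covariance is given by the kernel `Kker α`. -/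
def IsBridge {Ω : Type*} [MeasurableSpace Ω] (P : Measure Ω) (α : ℝ → ℝ)
    (X : ℝ → Ω → ℝ) : Prop :=
  (∀ (n : ℕ) (c t : Fin n → ℝ), (∀ i, 0 ≤ t i) →
    ∃ v : NNReal, P.map (fun ω => ∑ i, c i * X (t i) ω) = gaussianReal 0 v) ∧
  (∀ s t : ℝ, 0 ≤ s → 0 ≤ t → ∫ ω, X s ω * X t ω ∂P = Kker α s t)

/-- Growth conditions (i) and (ii) on `α`, with parameters `γ ∈ [0,1/2]`, `β > 0`. -/
def GrowthCond (α : ℝ → ℝ) (γ β : ℝ) : Prop :=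
  ContDiffOn ℝ 1 α (Set.Ici 0) ∧ γ ∈ Set.Icc (0:ℝ) (1/2) ∧ 0 < β ∧
    (∃ C > (0:ℝ), ∀ t > (0:ℝ), (alphaStar α (t+1)) ^ (2*γ) / α t ≤ C * t ^ (-β)) ∧
    (∃ C : ℝ, ∀ t ≥ (0:ℝ), |deriv α t / α t| ≤ C)

/-- The approximating local time `L^x_{t,ε} = ∫₀ᵗ (2πε)^{-1/2} exp(-(X_r - x)²/(2ε)) dr`. -/
noncomputable def locApprox {Ω : Type*} (X : ℝ → Ω → ℝ) (x ε t : ℝ) (ω : Ω) : ℝ :=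
  ∫ r in (0:ℝ)..t, (Real.sqrt (2 * Real.pi * ε))⁻¹ * Real.exp (-(X r ω - x)^2 / (2*ε))

open scoped ENNReal

/-- `u ↦ 1 / √u` with values in `[0, ∞]`, equal to `∞` for `u ≤ 0`. -/
noncomputable def invSqrt (u : ℝ) : ℝ≥0∞ := (ENNReal.ofReal √u)⁻¹

lemma measurable_invSqrt : Measurable invSqrt := by unfold invSqrt; fun_prop

lemma invSqrt_ne_zero (u : ℝ) : invSqrt u ≠ 0 := by simp [invSqrt]

lemma setLIntegral_invSqrt {δ : ℝ} (hδ : 0 ≤ δ) :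
    ∫⁻ u in Ioc 0 δ, invSqrt u = ENNReal.ofReal (2 * √δ) := by
  have hint : IntervalIntegrable (fun u : ℝ => u ^ (-(1 / 2) : ℝ)) volume 0 δ :=
    intervalIntegral.intervalIntegrable_rpow' (by norm_num)
  have hval : ∫ u in (0 : ℝ)..δ, u ^ (-(1 / 2) : ℝ) = 2 * √δ := by
    rw [integral_rpow (Or.inl (by norm_num)), Real.sqrt_eq_rpow, Real.zero_rpow (by norm_num)]
    norm_num
    ring
  rw [← hval, intervalIntegral.integral_of_le hδ, ofReal_integral_eq_lintegral_ofReal hint.1]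
  · refine setLIntegral_congr_fun measurableSet_Ioc fun u hu => ?_
    rw [Real.rpow_neg hu.1.le, ← Real.sqrt_eq_rpow,
      ENNReal.ofReal_inv_of_pos (Real.sqrt_pos.2 hu.1), invSqrt]
  · filter_upwards [ae_restrict_mem measurableSet_Ioc] with u hu
    exact Real.rpow_nonneg hu.1.le _

lemma lintegral_fin_succ {n : ℕ} {G : (Fin (n + 1) → ℝ) → ℝ≥0∞} (hG : Measurable G) :
    ∫⁻ r, G r = ∫⁻ a : ℝ, ∫⁻ r : Fin n → ℝ, G (Fin.cons a r) := by
  have h := (volume_preserving_piFinSuccAbove (fun _ : Fin (n + 1) => ℝ) 0).symm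
  rw [← h.lintegral_comp hG, Measure.volume_eq_prod, lintegral_prod]
  · simp [MeasurableEquiv.piFinSuccAbove, Fin.insertNthEquiv]
  · exact (hG.comp (MeasurableEquiv.measurable _)).aemeasurable

lemma measurable_fin_cons {n : ℕ} (a : ℝ) :
    Measurable fun r : Fin n → ℝ => (Fin.cons a r : Fin (n + 1) → ℝ) := by
  refine measurable_pi_lambda _ fun i => ?_
  induction i using Fin.cases with
  | zero => simp
  | succ j => simpa using measurable_pi_apply j

lemma lintegral_fin_prod_eq_pow (n : ℕ) {f : ℝ → ℝ≥0∞} (hf : Measurable f) :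
    ∫⁻ r : Fin n → ℝ, ∏ i, f (r i) = (∫⁻ a, f a) ^ n := by
  induction n with
  | zero => simp [volume_pi]
  | succ n ih =>
    rw [lintegral_fin_succ (by fun_prop)]
    simp only [Fin.prod_univ_succ, Fin.cons_zero, Fin.cons_succ]
    have (a : ℝ) : ∫⁻ r : Fin n → ℝ, f a * ∏ i, f (r i) = f a * (∫⁻ a, f a) ^ n := by
      rw [lintegral_const_mul _ (by fun_prop), ih]
    simp_rw [this]
    rw [lintegral_mul_const _ hf, pow_succ']

lemma lintegral_fin_prod_increments (n : ℕ) {h : ℝ → ℝ≥0∞} (hh : Measurable h) (s : ℝ) :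
    ∫⁻ r : Fin n → ℝ, ∏ i : Fin n, h (r i - (Fin.cons s r : Fin (n + 1) → ℝ) i.castSucc) =
      (∫⁻ u, h u) ^ n := by
  have hm (n : ℕ) (s : ℝ) : Measurable fun r : Fin n → ℝ =>
      ∏ i : Fin n, h (r i - (Fin.cons s r : Fin (n + 1) → ℝ) i.castSucc) :=
    Finset.measurable_prod _ fun i _ => hh.comp
      ((measurable_pi_apply i).sub ((measurable_pi_apply _).comp (measurable_fin_cons s)))
  induction n generalizing s with
  | zero => simp [volume_pi]
  | succ n ih =>
    rw [lintegral_fin_succ (hm _ s)]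
    simp only [Fin.prod_univ_succ, Fin.cons_zero, Fin.cons_succ, Fin.castSucc_zero,
      Fin.castSucc_succ]
    have (a : ℝ) : ∫⁻ r : Fin n → ℝ, h (a - s) *
        ∏ i : Fin n, h (r i - (Fin.cons a r : Fin (n + 1) → ℝ) i.castSucc) =
          h (a - s) * (∫⁻ u, h u) ^ n := by
      rw [lintegral_const_mul _ (hm _ a), ih]
    simp_rw [this]
    rw [lintegral_mul_const _ (by fun_prop), lintegral_sub_right_eq_self h s, pow_succ']

lemma measurableSet_monotone (n : ℕ) : MeasurableSet {r : Fin n → ℝ | Monotone r} := by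
  simp only [Monotone, Set.ofPred_forall]
  exact .iInter fun i => .iInter fun j => .iInter fun _ =>
    measurableSet_le (measurable_pi_apply i) (measurable_pi_apply j)

lemma lintegral_le_factorial_mul_setLIntegral_monotone {n : ℕ} {G : (Fin n → ℝ) → ℝ≥0∞}
    (hG : Measurable G) (hsymm : ∀ (σ : Equiv.Perm (Fin n)) r, G (r ∘ σ) = G r) :
    ∫⁻ r, G r ≤ n.factorial * ∫⁻ r in {r : Fin n → ℝ | Monotone r}, G r := by
  have hind : Measurable ({r : Fin n → ℝ | Monotone r}.indicator G) :=
    hG.indicator (measurableSet_monotone n)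
  have hperm (σ : Equiv.Perm (Fin n)) :
      MeasurePreserving (fun r : Fin n → ℝ => r ∘ σ) volume volume := by
    convert! volume_measurePreserving_piCongrLeft (fun _ : Fin n => ℝ) σ.symm using 1
    ext r i
    simp [MeasurableEquiv.piCongrLeft, Equiv.piCongrLeft, Equiv.piCongrLeft']
  calc ∫⁻ r, G r
      ≤ ∫⁻ r, ∑ σ : Equiv.Perm (Fin n), {r : Fin n → ℝ | Monotone r}.indicator G (r ∘ σ) := by
        refine lintegral_mono fun r => ?_
        have hs : r ∘ Tuple.sort r ∈ {r : Fin n → ℝ | Monotone r} := Tuple.monotone_sort r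
        calc G r = {r : Fin n → ℝ | Monotone r}.indicator G (r ∘ Tuple.sort r) := by
              rw [indicator_of_mem hs, hsymm]
          _ ≤ _ := Finset.single_le_sum
              (f := fun σ : Equiv.Perm (Fin n) =>
                {r : Fin n → ℝ | Monotone r}.indicator G (r ∘ σ))
              (fun _ _ => zero_le) (Finset.mem_univ _)
    _ = ∑ σ : Equiv.Perm (Fin n),
          ∫⁻ r, {r : Fin n → ℝ | Monotone r}.indicator G (r ∘ σ) :=
        lintegral_finsetSum _ fun σ _ => hind.comp (hperm σ).measurable
    _ = ∑ σ : Equiv.Perm (Fin n), ∫⁻ r, {r : Fin n → ℝ | Monotone r}.indicator G r :=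
        Finset.sum_congr rfl fun σ _ => (hperm σ).lintegral_comp hind
    _ = _ := by
        rw [lintegral_indicator (measurableSet_monotone n)]
        simp [Fintype.card_perm]

lemma lintegral_gaussianReal_comp_add_le (m y : ℝ) (v : NNReal) {f : ℝ → ℝ≥0∞}
    (hf : Measurable f) (hf0 : ∫⁻ a, f a ≠ 0) :
    ∫⁻ z, f (y + z) ∂gaussianReal m v ≤ invSqrt v * ∫⁻ a, f a := by
  rcases eq_or_ne v 0 with rfl | hv
  · simp [invSqrt, ENNReal.top_mul hf0]
  have hv' : (0 : ℝ) < v := by positivity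
  have hpdf (z : ℝ) : gaussianPDF m v z ≤ invSqrt v := by
    rw [gaussianPDF, invSqrt, ← ENNReal.ofReal_inv_of_pos (Real.sqrt_pos.2 hv'), gaussianPDFReal]
    refine ENNReal.ofReal_le_ofReal ?_
    have hexp : Real.exp (-(z - m) ^ 2 / (2 * v)) ≤ 1 :=
      Real.exp_le_one_iff.2 (div_nonpos_of_nonpos_of_nonneg (by nlinarith [sq_nonneg (z - m)])
        (by positivity))
    calc (√(2 * π * v))⁻¹ * Real.exp (-(z - m) ^ 2 / (2 * v)) ≤ (√(2 * π * v))⁻¹ * 1 := by gcongr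
      _ ≤ (√v)⁻¹ := by
        rw [mul_one]
        gcongr
        nlinarith [Real.pi_gt_three]
  rw [gaussianReal_of_var_ne_zero m hv, lintegral_withDensity_eq_lintegral_mul _
    (measurable_gaussianPDF m v) (by fun_prop)]
  calc ∫⁻ z, (gaussianPDF m v * fun z => f (y + z)) z
      ≤ ∫⁻ z, invSqrt v * f (y + z) := lintegral_mono fun z => by
        simpa using mul_le_mul_left (hpdf z) (f (y + z))
    _ = invSqrt v * ∫⁻ a, f a := by
        rw [lintegral_const_mul _ (by fun_prop), lintegral_add_left_eq_self f y]

section Coefficient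

variable {α : ℝ → ℝ}

lemma intervalIntegrable_of_continuousOn_Ici (hα : ContinuousOn α (Ici 0)) {a b : ℝ}
    (ha : 0 ≤ a) (hb : 0 ≤ b) : IntervalIntegrable α volume a b :=
  (hα.mono fun _ hu => (le_min ha hb).trans hu.1).intervalIntegrable

lemma Aint_sub (hα : ContinuousOn α (Ici 0)) {a b : ℝ} (ha : 0 ≤ a) (hb : 0 ≤ b) :
    Aint α b - Aint α a = ∫ u in a..b, α u :=
  intervalIntegral.integral_interval_sub_left
    (intervalIntegrable_of_continuousOn_Ici hα le_rfl hb)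
    (intervalIntegrable_of_continuousOn_Ici hα le_rfl ha)

lemma monotoneOn_Aint (hα : ContinuousOn α (Ici 0)) (hpos : ∀ t ≥ (0 : ℝ), 0 < α t) :
    MonotoneOn (Aint α) (Ici 0) := by
  intro a ha b hb hab
  rw [← sub_nonneg, Aint_sub hα ha hb]
  exact intervalIntegral.integral_nonneg hab fun u hu => (hpos u (le_trans ha hu.1)).le

lemma Aint_sub_le_mul_alphaStar (hα : ContinuousOn α (Ici 0)) (hpos : ∀ t ≥ (0 : ℝ), 0 < α t)
    {a b t : ℝ} (ha : 0 ≤ a) (hab : a ≤ b) (hbt : b ≤ t) :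
    Aint α b - Aint α a ≤ t * alphaStar α t := by
  have hle {u : ℝ} (hu : u ∈ Icc 0 t) : α u ≤ alphaStar α t :=
    le_csSup (isCompact_Icc.image_of_continuousOn (hα.mono fun _ h => h.1)).bddAbove
      (mem_image_of_mem α hu)
  have h0 : 0 ≤ alphaStar α t :=
    (hpos 0 le_rfl).le.trans (hle ⟨le_rfl, ha.trans (hab.trans hbt)⟩)
  rw [Aint_sub hα ha (ha.trans hab)]
  calc ∫ u in a..b, α u ≤ ∫ _ in a..b, alphaStar α t :=
        intervalIntegral.integral_mono_on hab
          (intervalIntegrable_of_continuousOn_Ici hα ha (ha.trans hab))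
          intervalIntegrable_const fun u hu => hle ⟨ha.trans hu.1, hu.2.trans hbt⟩
    _ = (b - a) * alphaStar α t := by simp
    _ ≤ t * alphaStar α t := by gcongr; linarith

lemma mul_exp_Aint_le_integral_sub (hα : ContinuousOn α (Ici 0))
    (hpos : ∀ t ≥ (0 : ℝ), 0 < α t) {a b : ℝ} (ha : 0 ≤ a) (hab : a ≤ b) :
    (b - a) * Real.exp (2 * Aint α a) ≤
      (∫ u in (0 : ℝ)..b, Real.exp (2 * Aint α u)) -
        ∫ u in (0 : ℝ)..a, Real.exp (2 * Aint α u) := by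
  have hmono : MonotoneOn (fun u => Real.exp (2 * Aint α u)) (Ici 0) := fun x hx y hy hxy =>
    Real.exp_le_exp.2 (by linarith [monotoneOn_Aint hα hpos hx hy hxy])
  have hint {x y : ℝ} (hx : 0 ≤ x) (hy : 0 ≤ y) :
      IntervalIntegrable (fun u => Real.exp (2 * Aint α u)) volume x y :=
    (hmono.mono fun _ hu => (le_min hx hy).trans hu.1).intervalIntegrable
  have hb := ha.trans hab
  rw [intervalIntegral.integral_interval_sub_left (hint le_rfl hb) (hint le_rfl ha)]
  calc (b - a) * Real.exp (2 * Aint α a) = ∫ _ in a..b, Real.exp (2 * Aint α a) := by simp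
    _ ≤ _ := intervalIntegral.integral_mono_on hab intervalIntegrable_const (hint ha hb)
        fun u hu => hmono ha (ha.trans hu.1) hu.1

end Coefficient

section Bridge

variable {Ω : Type*} [MeasurableSpace Ω] {P : Measure Ω} {α : ℝ → ℝ} {X : ℝ → Ω → ℝ}

lemma IsBridge.hasGaussianLaw (hX : IsBridge P α X) (hm : ∀ t, Measurable (X t)) {n : ℕ}
    {ρ : Fin n → ℝ} (hρ : ∀ i, 0 ≤ ρ i) : HasGaussianLaw (fun ω i => X (ρ i) ω) P where
  isGaussian_map := by
    refine isGaussian_of_map_eq_gaussianReal fun L => ?_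
    obtain ⟨v, hv⟩ := hX.1 n (fun i => L (Pi.single i 1)) ρ hρ
    refine ⟨0, v, ?_⟩
    rw [Measure.map_map (by fun_prop) (by fun_prop), ← hv]
    congr 1
    ext ω
    have h := pi_eq_sum_univ' (fun i => X (ρ i) ω)
    simp only [Function.comp_apply]
    conv_lhs => rw [h]
    simp [map_sum, mul_comm, Pi.single]

lemma IsBridge.integral_eq_zero (hX : IsBridge P α X) (hm : ∀ t, Measurable (X t)) {t : ℝ}
    (ht : 0 ≤ t) : ∫ ω, X t ω ∂P = 0 := by
  obtain ⟨v, hv⟩ := hX.1 1 (fun _ => 1) (fun _ => t) fun _ => ht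
  simp only [Finset.univ_unique, one_mul, Finset.sum_const, Finset.card_singleton, one_smul] at hv
  have h := integral_id_gaussianReal (μ := 0) (v := v)
  rw [← hv, integral_map (hm t).aemeasurable (by fun_prop)] at h
  exact h

lemma IsBridge.memLp_two (hX : IsBridge P α X) (hm : ∀ t, Measurable (X t)) {t : ℝ}
    (ht : 0 ≤ t) : MemLp (X t) 2 P :=
  ((hX.hasGaussianLaw hm (ρ := fun _ : Fin 1 => t) fun _ => ht).eval 0).memLp_two

lemma IsBridge.covariance_eq [IsProbabilityMeasure P] (hX : IsBridge P α X)
    (hm : ∀ t, Measurable (X t)) {s t : ℝ} (hs : 0 ≤ s) (ht : 0 ≤ t) :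
    cov[X s, X t; P] = Kker α s t := by
  rw [covariance_eq_sub (hX.memLp_two hm hs) (hX.memLp_two hm ht), hX.integral_eq_zero hm hs,
    zero_mul, sub_zero]
  exact hX.2 s t hs ht

/-- The Markov step: conditionally on the values of `X` up to time `ρ (Fin.last n)`, the density of
`X t` is bounded by `exp (A t - A (ρ (Fin.last n))) / √(t - ρ (Fin.last n))`. -/
lemma IsBridge.lintegral_mul_comp_le [IsProbabilityMeasure P] (hX : IsBridge P α X)
    (hα : ContinuousOn α (Ici 0)) (hpos : ∀ t ≥ (0 : ℝ), 0 < α t)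
    (hm : ∀ t, Measurable (X t)) {n : ℕ} {ρ : Fin (n + 1) → ℝ} (hρ : ∀ i, 0 ≤ ρ i)
    (hlast : ∀ i, ρ i ≤ ρ (Fin.last n)) {t : ℝ} (ht : ρ (Fin.last n) ≤ t)
    {F : (Fin (n + 1) → ℝ) → ℝ≥0∞} (hF : Measurable F) {f : ℝ → ℝ≥0∞} (hf : Measurable f)
    (hf1 : ∫⁻ a, f a = 1) :
    ∫⁻ ω, F (fun i => X (ρ i) ω) * f (X t ω) ∂P ≤ (∫⁻ ω, F (fun i => X (ρ i) ω) ∂P) *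
      (ENNReal.ofReal (Real.exp (Aint α t - Aint α (ρ (Fin.last n)))) *
        invSqrt (t - ρ (Fin.last n))) := by
  set a := ρ (Fin.last n) with ha_def
  have ha : 0 ≤ a := hρ _
  have ht0 : 0 ≤ t := ha.trans ht
  set c : ℝ := Real.exp (Aint α a - Aint α t) with hc
  let U : Ω → Fin (n + 1) → ℝ := fun ω i => X (ρ i) ω
  let D : Ω → ℝ := fun ω => X t ω - c * X a ω
  have hU : Measurable U := measurable_pi_lambda _ fun i => hm _
  have hD : Measurable D := (hm t).sub ((hm a).const_mul c)
  have hL2 {s : ℝ} (hs : 0 ≤ s) := hX.memLp_two hm hs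
  have hcov {s s' : ℝ} (hs : 0 ≤ s) (hs' : 0 ≤ s') := hX.covariance_eq hm hs hs'
  have hjoint : HasGaussianLaw (fun ω => (U ω, fun _ : Unit => D ω)) P := by
    have hρ' : ∀ i, 0 ≤ (Fin.snoc ρ t : Fin (n + 2) → ℝ) i := fun i => by
      induction i using Fin.lastCases with
      | last => simpa using ht0
      | cast j => simpa using hρ j
    let pr (i : Fin (n + 2)) : (Fin (n + 2) → ℝ) →L[ℝ] ℝ := ContinuousLinearMap.proj i
    have h := (hX.hasGaussianLaw hm hρ').map_fun
      ((ContinuousLinearMap.pi fun i : Fin (n + 1) => pr i.castSucc).prod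
        (ContinuousLinearMap.pi fun _ : Unit => pr (Fin.last _) - c • pr (Fin.last n).castSucc))
    convert! h using 2 with ω
    ext <;> simp [pr, U, D, a]
  have hindep : IndepFun U D P := by
    have h := hjoint.indepFun_of_covariance_eval (X := fun i => X (ρ i)) (Y := fun _ => D)
      fun i _ => by
        rw [covariance_fun_sub_right (hL2 (hρ i)) (hL2 ht0) ((hL2 ha).const_mul c),
          covariance_const_mul_right, hcov (hρ i) ht0, hcov (hρ i) ha, Kker, Kker,
          min_eq_left (hlast i), min_eq_left ((hlast i).trans ht), hc, ← mul_assoc, ← Real.exp_add]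
        ring_nf
    exact h.comp measurable_id (measurable_pi_apply ())
  have hDlaw : HasGaussianLaw D P := hjoint.snd.eval ()
  have hvar : c ^ 2 * (t - a) ≤ Var[D; P] := by
    have hca := (hL2 ha).const_mul c
    rw [← covariance_self hD.aemeasurable, covariance_fun_sub_fun_sub (hL2 ht0) hca (hL2 ht0) hca,
      covariance_const_mul_right, covariance_const_mul_left, covariance_const_mul_left,
      covariance_const_mul_right, hcov ht0 ht0, hcov ht0 ha, hcov ha ht0, hcov ha ha, Kker, Kker,
      Kker, Kker, min_self, min_self, min_eq_right ht, min_eq_left ht]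
    have e1 : c * Real.exp (-Aint α t - Aint α a) = Real.exp (-Aint α t - Aint α t) := by
      rw [hc, ← Real.exp_add]; ring_nf
    have e2 : c * Real.exp (-Aint α a - Aint α t) = Real.exp (-Aint α t - Aint α t) := by
      rw [hc, ← Real.exp_add]; ring_nf
    have e3 : c * (c * Real.exp (-Aint α a - Aint α a)) = Real.exp (-Aint α t - Aint α t) := by
      rw [hc, ← Real.exp_add, ← Real.exp_add]; ring_nf
    have e4 : c ^ 2 = Real.exp (-Aint α t - Aint α t) * Real.exp (2 * Aint α a) := by
      rw [hc, ← Real.exp_add, ← Real.exp_nat_mul]; push_cast; ring_nf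
    simp only [← mul_assoc] at e3 ⊢
    rw [e1, e2, e3, e4]
    have := mul_le_mul_of_nonneg_left (mul_exp_Aint_le_integral_sub hα hpos ha ht)
      (Real.exp_pos (-Aint α t - Aint α t)).le
    linarith
  have hk : invSqrt (Var[D; P].toNNReal : ℝ) ≤
      ENNReal.ofReal (Real.exp (Aint α t - Aint α a)) * invSqrt (t - a) := by
    have hc' : Real.exp (Aint α t - Aint α a) = c⁻¹ := by rw [hc, ← Real.exp_neg]; ring_nf
    have hc0 : 0 < c := Real.exp_pos _
    rw [hc', ENNReal.ofReal_inv_of_pos hc0, invSqrt, invSqrt,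
      ← ENNReal.mul_inv (Or.inl (by simpa using hc0)) (Or.inl (by simp)),
      ← ENNReal.ofReal_mul hc0.le]
    refine ENNReal.inv_le_inv.2 (ENNReal.ofReal_le_ofReal ?_)
    rw [Real.coe_toNNReal _ (variance_nonneg _ _)]
    refine Real.le_sqrt_of_sq_le ?_
    rwa [mul_pow, Real.sq_sqrt (by linarith)]
  have hGm : Measurable fun q : (Fin (n + 1) → ℝ) × ℝ => F q.1 * f (c * q.1 (Fin.last n) + q.2) :=
    by fun_prop
  calc ∫⁻ ω, F (fun i => X (ρ i) ω) * f (X t ω) ∂P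
      = ∫⁻ ω, F (U ω) * f (c * U ω (Fin.last n) + D ω) ∂P := by simp [U, D, a]
    _ = ∫⁻ q, F q.1 * f (c * q.1 (Fin.last n) + q.2) ∂(P.map U).prod (P.map D) := by
        rw [← (indepFun_iff_map_prod_eq_prod_map_map hU.aemeasurable hD.aemeasurable).1 hindep,
          lintegral_map hGm (hU.prodMk hD)]
    _ = ∫⁻ u, F u * ∫⁻ z, f (c * u (Fin.last n) + z) ∂P.map D ∂P.map U := by
        have := Measure.isProbabilityMeasure_map (μ := P) hD.aemeasurable
        rw [lintegral_prod _ hGm.aemeasurable]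
        exact lintegral_congr fun u =>
          lintegral_const_mul (F u) (f := fun z => f (c * u (Fin.last n) + z)) (by fun_prop)
    _ ≤ ∫⁻ u, F u * (ENNReal.ofReal (Real.exp (Aint α t - Aint α a)) * invSqrt (t - a))
          ∂P.map U := by
        refine lintegral_mono fun u => ?_
        gcongr
        rw [hDlaw.map_eq_gaussianReal]
        refine (lintegral_gaussianReal_comp_add_le _ _ _ hf (by simp [hf1])).trans ?_
        rwa [hf1, mul_one]
    _ = _ := by
        rw [lintegral_mul_const _ hF, lintegral_map hF hU]

lemma IsBridge.lintegral_prod_comp_le [IsProbabilityMeasure P] (hX : IsBridge P α X)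
    (hα : ContinuousOn α (Ici 0)) (hpos : ∀ t ≥ (0 : ℝ), 0 < α t)
    (hm : ∀ t, Measurable (X t)) {f : ℝ → ℝ≥0∞} (hf : Measurable f) (hf1 : ∫⁻ a, f a = 1)
    {n : ℕ} {ρ : Fin (n + 1) → ℝ} (hρ : ∀ i, 0 ≤ ρ i) (hmono : Monotone ρ) :
    ∫⁻ ω, ∏ i : Fin n, f (X (ρ i.succ) ω) ∂P ≤
      ENNReal.ofReal (Real.exp (Aint α (ρ (Fin.last n)) - Aint α (ρ 0))) *
        ∏ i : Fin n, invSqrt (ρ i.succ - ρ i.castSucc) := by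
  induction n with
  | zero => simp
  | succ n ih =>
    have hstep := hX.lintegral_mul_comp_le hα hpos hm (ρ := fun i : Fin (n + 1) => ρ i.castSucc)
      (fun i => hρ _) (fun i => hmono (Fin.castSucc_le_castSucc_iff.2 (Fin.le_last i)))
      (hmono (Fin.castSucc_lt_last (Fin.last n)).le)
      (F := fun u => ∏ i : Fin n, f (u i.succ)) (by fun_prop) hf hf1
    have hih := ih (ρ := fun i : Fin (n + 1) => ρ i.castSucc) (fun i => hρ _)
      (hmono.comp Fin.strictMono_castSucc.monotone)
    simp only [Fin.prod_univ_castSucc, Fin.succ_castSucc, Fin.succ_last, Fin.castSucc_zero]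
      at hstep hih ⊢
    refine hstep.trans ((mul_le_mul_left hih _).trans_eq ?_)
    rw [show Aint α (ρ (Fin.last (n + 1))) - Aint α (ρ 0) =
      (Aint α (ρ (Fin.last n).castSucc) - Aint α (ρ 0)) +
        (Aint α (ρ (Fin.last (n + 1))) - Aint α (ρ (Fin.last n).castSucc)) by ring,
      Real.exp_add, ENNReal.ofReal_mul (Real.exp_pos _).le]
    ring

end Bridge

section Moments

variable {Ω : Type*} [MeasurableSpace Ω] {P : Measure Ω} {α : ℝ → ℝ} {X : ℝ → Ω → ℝ}

lemma IsBridge.lintegral_pow_occupation_le [IsProbabilityMeasure P] (hX : IsBridge P α X)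
    (hα : ContinuousOn α (Ici 0)) (hpos : ∀ t ≥ (0 : ℝ), 0 < α t)
    (hmeas : Measurable (Function.uncurry X)) {f : ℝ → ℝ≥0∞} (hf : Measurable f)
    (hf1 : ∫⁻ a, f a = 1) {p : ℕ} {s t : ℝ} (hs : 0 ≤ s) (hst : s ≤ t) :
    ∫⁻ ω, (∫⁻ r in Ioc s t, f (X r ω)) ^ p ∂P ≤
      p.factorial * (ENNReal.ofReal (Real.exp (t * alphaStar α t)) *
        ENNReal.ofReal (2 * √(t - s)) ^ p) := by
  have hm (t : ℝ) : Measurable (X t) := hmeas.comp measurable_prodMk_left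
  let w (r : ℝ) (ω : Ω) : ℝ≥0∞ := (Ioc s t).indicator (fun r => f (X r ω)) r
  have hw : Measurable (Function.uncurry w) :=
    (hf.comp hmeas).indicator (measurable_fst measurableSet_Ioc)
  have hprod : Measurable fun q : Ω × (Fin p → ℝ) => ∏ i, w (q.2 i) q.1 :=
    Finset.measurable_prod _ fun i _ => by
      have hi : Measurable fun q : Ω × (Fin p → ℝ) => (q.2 i, q.1) := by fun_prop
      exact hw.comp hi
  let h : ℝ → ℝ≥0∞ := (Icc 0 (t - s)).indicator invSqrt
  have hh : Measurable h := measurable_invSqrt.indicator measurableSet_Icc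
  have hh_int : ∫⁻ u, h u = ENNReal.ofReal (2 * √(t - s)) := by
    rw [lintegral_indicator measurableSet_Icc, ← setLIntegral_invSqrt (sub_nonneg.2 hst),
      restrict_Ioc_eq_restrict_Icc]
  have hbound (r : Fin p → ℝ) (hr : Monotone r) : ∫⁻ ω, ∏ i, w (r i) ω ∂P ≤
      ENNReal.ofReal (Real.exp (t * alphaStar α t)) *
        ∏ i : Fin p, h (r i - (Fin.cons s r : Fin (p + 1) → ℝ) i.castSucc) := by
    by_cases hmem : ∀ i, r i ∈ Ioc s t
    · set ρ : Fin (p + 1) → ℝ := Fin.cons s r with hρ_def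
      have hρ_mem (i : Fin (p + 1)) : ρ i ∈ Icc s t := by
        induction i using Fin.cases with
        | zero => exact ⟨le_rfl, hst⟩
        | succ j => exact Ioc_subset_Icc_self (hmem j)
      have hρ_mono : Monotone ρ := by
        intro i j hij
        induction i using Fin.cases with
        | zero => exact (hρ_mem j).1
        | succ i =>
          induction j using Fin.cases with
          | zero => simp at hij
          | succ j => exact hr (Fin.succ_le_succ_iff.1 hij)
      have key := hX.lintegral_prod_comp_le hα hpos hm hf hf1
        (fun i => hs.trans (hρ_mem i).1) hρ_mono
      have hw_eq (i : Fin p) (ω : Ω) : w (r i) ω = f (X (ρ i.succ) ω) := by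
        simp [w, ρ, indicator_of_mem (hmem i)]
      have hh_eq (i : Fin p) : h (r i - ρ i.castSucc) = invSqrt (ρ i.succ - ρ i.castSucc) := by
        have h1 := hρ_mono i.castSucc_le_succ
        have h2 := (hρ_mem i.succ).2
        have h3 := (hρ_mem i.castSucc).1
        have hu : ρ i.succ - ρ i.castSucc ∈ Icc 0 (t - s) := ⟨by linarith, by linarith⟩
        exact indicator_of_mem hu invSqrt
      simp_rw [hw_eq, hh_eq]
      refine key.trans (mul_le_mul_left (ENNReal.ofReal_le_ofReal (Real.exp_le_exp.2 ?_)) _)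
      exact Aint_sub_le_mul_alphaStar hα hpos hs (hρ_mem _).1 (hρ_mem _).2
    · obtain ⟨j, hj⟩ := not_forall.1 hmem
      have hzero (ω : Ω) : ∏ i, w (r i) ω = 0 :=
        Finset.prod_eq_zero (Finset.mem_univ j) (indicator_of_notMem hj _)
      simp [hzero]
  calc ∫⁻ ω, (∫⁻ r in Ioc s t, f (X r ω)) ^ p ∂P
      = ∫⁻ ω, (∫⁻ r : Fin p → ℝ, ∏ i, w (r i) ω) ∂P := by
        refine lintegral_congr fun ω => ?_
        rw [lintegral_fin_prod_eq_pow p (f := fun r => w r ω) (hw.comp measurable_prodMk_right),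
          lintegral_indicator measurableSet_Ioc]
    _ = ∫⁻ r : Fin p → ℝ, ∫⁻ ω, ∏ i, w (r i) ω ∂P := lintegral_lintegral_swap hprod.aemeasurable
    _ ≤ p.factorial * ∫⁻ r in {r : Fin p → ℝ | Monotone r}, ∫⁻ ω, ∏ i, w (r i) ω ∂P :=
        lintegral_le_factorial_mul_setLIntegral_monotone hprod.lintegral_prod_left'
          fun σ r => lintegral_congr fun ω => Equiv.prod_comp σ fun i => w (r i) ω
    _ ≤ p.factorial * ∫⁻ r : Fin p → ℝ, ENNReal.ofReal (Real.exp (t * alphaStar α t)) *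
          ∏ i : Fin p, h (r i - (Fin.cons s r : Fin (p + 1) → ℝ) i.castSucc) := by
        refine mul_le_mul_right ?_ _
        exact (setLIntegral_mono' (measurableSet_monotone p) hbound).trans
          (setLIntegral_le_lintegral _ _)
    _ = _ := by
        rw [lintegral_const_mul' _ _ ENNReal.ofReal_ne_top, lintegral_fin_prod_increments p hh,
          hh_int]

lemma enorm_locApprox_sub_le (hmeas : Measurable (Function.uncurry X)) (x : ℝ) {ε : NNReal}
    {s t : ℝ} (hst : s ≤ t) (ω : Ω) :
    ‖locApprox X x ε t ω - locApprox X x ε s ω‖ₑ ≤ ∫⁻ r in Ioc s t, gaussianPDF x ε (X r ω) := by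
  have hmω : Measurable fun r => X r ω := hmeas.comp measurable_prodMk_right
  have hint (a b : ℝ) : IntervalIntegrable
      (fun r => (√(2 * π * ε))⁻¹ * Real.exp (-(X r ω - x) ^ 2 / (2 * ε))) volume a b := by
    refine (intervalIntegrable_const (c := (√(2 * π * ε))⁻¹)).mono_fun
      (by fun_prop) (.of_forall fun r => ?_)
    have hexp : Real.exp (-(X r ω - x) ^ 2 / (2 * ε)) ≤ 1 :=
      Real.exp_le_one_iff.2 (div_nonpos_of_nonpos_of_nonneg
        (by nlinarith [sq_nonneg (X r ω - x)]) (by positivity))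
    simp only [norm_mul, Real.norm_of_nonneg (Real.exp_pos _).le]
    exact mul_le_of_le_one_right (norm_nonneg _) hexp
  rw [locApprox, locApprox, intervalIntegral.integral_interval_sub_left (hint 0 t) (hint 0 s),
    intervalIntegral.integral_of_le hst]
  refine (enorm_integral_le_lintegral_enorm _).trans_eq (lintegral_congr fun r => ?_)
  rw [← gaussianPDFReal, gaussianPDF, Real.enorm_of_nonneg (gaussianPDFReal_nonneg _ _ _)]

end Moments

theorem stmt_16 {Ω : Type*} [MeasurableSpace Ω] (P : Measure Ω) [IsProbabilityMeasure P]
    (α : ℝ → ℝ) (X : ℝ → Ω → ℝ)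
    (hα_pos : ∀ t ≥ (0:ℝ), 0 < α t)
    (hα_cont : ContinuousOn α (Set.Ici 0))
    (hX : IsBridge P α X)
    (hmeas : Measurable (Function.uncurry X)) :
    ∀ p : ℕ, 0 < p → ∃ C > (0:ℝ), ∀ x : ℝ, ∀ s t : ℝ, 0 ≤ s → s ≤ t → t - s ≤ 1 →
      ∀ ε > (0:ℝ),
        ∫ ω, |locApprox X x ε t ω - locApprox X x ε s ω| ^ p ∂P ≤
          C * ((p.factorial : ℝ) / Real.Gamma (((p:ℝ) + 1) / 2)) *
            (t - s) ^ ((p:ℝ)/2) * Real.exp (t * alphaStar α t) := by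
  intro p hp
  have hΓ : 0 < Real.Gamma (((p : ℝ) + 1) / 2) := Real.Gamma_pos_of_pos (by positivity)
  refine ⟨2 ^ p * Real.Gamma (((p : ℝ) + 1) / 2), by positivity, ?_⟩
  intro x s t hs hst _ ε hε
  lift ε to NNReal using hε.le
  have hε0 : ε ≠ 0 := by
    rintro rfl
    simp at hε
  have hts : 0 ≤ t - s := sub_nonneg.2 hst
  have hrhs : 2 ^ p * Real.Gamma (((p : ℝ) + 1) / 2) *
      ((p.factorial : ℝ) / Real.Gamma (((p : ℝ) + 1) / 2)) * (t - s) ^ ((p : ℝ) / 2) *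
        Real.exp (t * alphaStar α t) =
      p.factorial * (Real.exp (t * alphaStar α t) * (2 * √(t - s)) ^ p) := by
    rw [mul_pow, Real.sqrt_eq_rpow, ← Real.rpow_mul_natCast hts]
    field_simp
  rw [hrhs, ← ENNReal.ofReal_le_ofReal_iff (by positivity),
    ← Real.enorm_of_nonneg (integral_nonneg fun _ => by positivity)]
  calc ‖∫ ω, |locApprox X x ε t ω - locApprox X x ε s ω| ^ p ∂P‖ₑ
      ≤ ∫⁻ ω, ‖|locApprox X x ε t ω - locApprox X x ε s ω| ^ p‖ₑ ∂P :=
        enorm_integral_le_lintegral_enorm _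
    _ ≤ ∫⁻ ω, (∫⁻ r in Ioc s t, gaussianPDF x ε (X r ω)) ^ p ∂P := by
        refine lintegral_mono fun ω => ?_
        rw [enorm_pow, enorm_abs]
        gcongr
        exact enorm_locApprox_sub_le hmeas x hst ω
    _ ≤ p.factorial * (ENNReal.ofReal (Real.exp (t * alphaStar α t)) *
          ENNReal.ofReal (2 * √(t - s)) ^ p) :=
        hX.lintegral_pow_occupation_le hα_cont hα_pos hmeas (measurable_gaussianPDF x ε)
          (lintegral_gaussianPDF_eq_one x hε0) hs hst
    _ = ENNReal.ofReal (p.factorial * (Real.exp (t * alphaStar α t) * (2 * √(t - s)) ^ p)) := by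
        rw [ENNReal.ofReal_mul (Nat.cast_nonneg _), ENNReal.ofReal_mul (Real.exp_pos _).le,
          ENNReal.ofReal_pow (by positivity), ENNReal.ofReal_natCast]
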